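/- Let 𝒳 and 𝒴 be finite types and T ⊆ 𝒳 × 𝒴. Then T is a combinatorial triangle if and only if there exist labellings of the rows a : 𝒳 → ℝ and of the columns b : 𝒴 → ℝ such that T = {(x, y) : a x < b y}. -/

import Mathlib

/-- A set `T ⊆ 𝒳 × 𝒴` is a combinatorial triangle if for all `(x, y) ∈ T` and
`(x', y') ∈ T`, at least one of `(x, y') ∈ T` or `(x', y) ∈ T` holds. -/
def IsTriangle {𝒳 𝒴 : Type*} (T : Set (𝒳 × 𝒴)) : Prop :=
  ∀ ⦃x : 𝒳⦄ ⦃y : 𝒴⦄ ⦃x' : 𝒳⦄ ⦃y' : 𝒴⦄,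
    (x, y) ∈ T → (x', y') ∈ T → (x, y') ∈ T ∨ (x', y) ∈ T

/-- Two columns of a combinatorial triangle are nested: a column missing a row `x` is strictly
contained in every column containing `x`. -/
theorem IsTriangle.column_ssubset {𝒳 𝒴 : Type*} {T : Set (𝒳 × 𝒴)} (hT : IsTriangle T)
    {x : 𝒳} {y y' : 𝒴} (hy : (x, y) ∈ T) (hy' : (x, y') ∉ T) :
    {z : 𝒳 | (z, y') ∈ T} ⊂ {z : 𝒳 | (z, y) ∈ T} :=
  (Set.ssubset_iff_of_subset fun z (hz : (z, y') ∈ T) =>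
    (hT hy hz).resolve_left hy').2 ⟨x, hy, hy'⟩

/-- For finite `𝒳`, `𝒴`, a set `T ⊆ 𝒳 × 𝒴` is a combinatorial triangle if and only if
there are labellings of the rows `a : 𝒳 → ℝ` and of the columns `b : 𝒴 → ℝ` such that
`T = {(x, y) : a x < b y}`. -/
theorem isTriangle_iff_labelling {𝒳 𝒴 : Type*} [Fintype 𝒳] [Fintype 𝒴]
    (T : Set (𝒳 × 𝒴)) :
    IsTriangle T ↔
      ∃ (a : 𝒳 → ℝ) (b : 𝒴 → ℝ), T = {p : 𝒳 × 𝒴 | a p.1 < b p.2} := by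
  classical
  constructor
  · intro hT
    let c : 𝒴 → ℕ := fun y => {z : 𝒳 | (z, y) ∈ T}.ncard
    let r : 𝒳 → ℕ := fun x => (Finset.univ.filter fun y => (x, y) ∉ T).sup c
    refine ⟨fun x => r x, fun y => c y, ?_⟩
    ext ⟨x, y⟩
    rw [Set.mem_ofPred_eq, Nat.cast_lt]
    constructor
    · intro hxy
      have hpos : 0 < c y := (Set.ncard_pos (Set.toFinite _)).2 ⟨x, hxy⟩
      refine (Finset.sup_lt_iff hpos).2 fun y' hy' => ?_
      exact Set.ncard_lt_ncard
        (hT.column_ssubset hxy (Finset.mem_filter.1 hy').2) (Set.toFinite _)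
    · intro hlt
      by_contra hxy
      exact hlt.not_ge
        (Finset.le_sup (f := c) (Finset.mem_filter.2 ⟨Finset.mem_univ y, hxy⟩))
  · rintro ⟨a, b, rfl⟩ x y x' y' h h'
    simp only [Set.mem_ofPred_eq] at h h' ⊢
    by_contra! hcon
    linarith
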